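/- Lipschitz gradient bound: F(b) = f(ρ(b)) with ρ_i(b) = κ_i 4^{b_i} is C^∞ on ℝ^m, and its Hessian satisfies ‖∇²F(b)‖₂ ≤ (ln 4)² ‖C_x‖₂ (2m+1) for all b, hence ∇F is Lipschitz on any convex set with constant L = (ln 4)² ‖C_x‖₂ (2m+1). -/

import Mathlib

open Matrix

/-- Spectral norm (ℓ2 operator norm) of a real square matrix. -/
noncomputable def specNorm {d : ℕ} (A : Matrix (Fin d) (Fin d) ℝ) : ℝ :=
  ‖Matrix.toEuclideanCLM (𝕜 := ℝ) A‖

section Calculus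

open scoped Matrix.Norms.Operator

variable {n ι : Type*} [Fintype ι]

/-- The weighted Gram matrix `Hᵀ diag(a) H`, as a linear function of the weights `a`. -/
noncomputable def weightedGram [DecidableEq ι] (H : Matrix ι n ℝ) : (ι → ℝ) →L[ℝ] Matrix n n ℝ :=
  LinearMap.toContinuousLinearMap
    { toFun := fun a => Hᵀ * Matrix.diagonal a * H
      map_add' := fun a b => by
        simp only [← Matrix.mul_add, ← Matrix.add_mul, Matrix.diagonal_add]
        rfl
      map_smul' := fun r a => by
        rw [Matrix.diagonal_smul, Matrix.mul_smul, Matrix.smul_mul, RingHom.id_apply] }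

theorem weightedGram_apply [DecidableEq ι] (H : Matrix ι n ℝ) (a : ι → ℝ) :
    weightedGram H a = Hᵀ * Matrix.diagonal a * H := rfl

theorem weightedGram_transpose [DecidableEq ι] (H : Matrix ι n ℝ) (a : ι → ℝ) :
    (weightedGram H a)ᵀ = weightedGram H a := by
  simp [weightedGram_apply, Matrix.mul_assoc]

variable [Fintype n]

theorem HasDerivAt.matrix_nonsing_inv [DecidableEq n] {A : ℝ → Matrix n n ℝ} {A' : Matrix n n ℝ}
    {t : ℝ}
    (hA : HasDerivAt A A' t) (hu : IsUnit (A t)) :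
    HasDerivAt (fun s => (A s)⁻¹) (-((A t)⁻¹ * A' * (A t)⁻¹)) t := by
  obtain ⟨u, hu⟩ := hu
  have h := (hasFDerivAt_ringInverse (𝕜 := ℝ) u).comp_hasDerivAt_of_eq t hA hu
  have hinv : ((u⁻¹ : (Matrix n n ℝ)ˣ) : Matrix n n ℝ) = (A t)⁻¹ := by
    rw [← hu, Matrix.coe_units_inv]
  simp only [Function.comp_def, ← Matrix.nonsing_inv_eq_ringInverse, hinv,
    _root_.neg_apply, ContinuousLinearMap.mulLeftRight_apply] at h
  exact h

theorem HasDerivAt.matrix_trace {A : ℝ → Matrix n n ℝ} {A' : Matrix n n ℝ} {t : ℝ}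
    (hA : HasDerivAt A A' t) : HasDerivAt (fun s => (A s).trace) A'.trace t :=
  (LinearMap.toContinuousLinearMap (Matrix.traceLinearMap n ℝ ℝ)).hasFDerivAt.comp_hasDerivAt t hA

theorem HasDerivAt.weightedGram [DecidableEq ι] (H : Matrix ι n ℝ) {a : ℝ → ι → ℝ} {a' : ι → ℝ}
    {t : ℝ}
    (ha : HasDerivAt a a' t) :
    HasDerivAt (fun s => weightedGram H (a s)) (weightedGram H a') t :=
  (_root_.weightedGram H).hasFDerivAt.comp_hasDerivAt t ha

theorem contDiff_trace_inv_add_weightedGram [DecidableEq n] [DecidableEq ι] {E : Type*}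
    [NormedAddCommGroup E] [NormedSpace ℝ E]
    (P : Matrix n n ℝ) (H : Matrix ι n ℝ) {a : E → ι → ℝ} {k : WithTop ℕ∞}
    (ha : ContDiff ℝ k a) (hu : ∀ x, IsUnit (P + weightedGram H (a x))) :
    ContDiff ℝ k fun x => (P + weightedGram H (a x))⁻¹.trace := by
  have hinv : ContDiff ℝ k fun x => (P + weightedGram H (a x))⁻¹ := by
    rw [contDiff_iff_contDiffAt]
    intro x
    obtain ⟨u, hu⟩ := hu x
    have h : ContDiffAt ℝ k (fun x => P + weightedGram H (a x)) x :=
      (contDiff_const.add ((weightedGram H).contDiff.comp ha)).contDiffAt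
    have h' := contDiffAt_ringInverse ℝ (n := k) u
    rw [hu] at h'
    simpa [Function.comp_def, ← Matrix.nonsing_inv_eq_ringInverse] using h'.comp x h
  exact (LinearMap.toContinuousLinearMap (Matrix.traceLinearMap n ℝ ℝ)).contDiff.comp hinv

/-- First derivative of `tr (P + Hᵀ diag(a) H)⁻¹` along a curve of weights. -/
theorem HasDerivAt.trace_inv_add_weightedGram [DecidableEq n] [DecidableEq ι] (P : Matrix n n ℝ)
    (H : Matrix ι n ℝ)
    {a : ℝ → ι → ℝ} {a' : ι → ℝ} {t : ℝ} (ha : HasDerivAt a a' t)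
    (hu : IsUnit (P + _root_.weightedGram H (a t))) :
    HasDerivAt (fun s => (P + _root_.weightedGram H (a s))⁻¹.trace)
      (-((P + _root_.weightedGram H (a t))⁻¹ * _root_.weightedGram H a' *
        (P + _root_.weightedGram H (a t))⁻¹).trace) t := by
  simpa only [Matrix.trace_neg] using
    (((ha.weightedGram H).const_add P).matrix_nonsing_inv hu).matrix_trace

/-- Derivative of the first variation of `tr (P + Hᵀ diag(a) H)⁻¹` along a curve of weights `a`
and of variations `c`. -/
theorem HasDerivAt.trace_inv_mul_weightedGram_mul_inv [DecidableEq n] [DecidableEq ι]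
    (P : Matrix n n ℝ) (H : Matrix ι n ℝ)
    {a c : ℝ → ι → ℝ} {a' c' : ι → ℝ} {t : ℝ} (ha : HasDerivAt a a' t) (hc : HasDerivAt c c' t)
    (hu : IsUnit (P + _root_.weightedGram H (a t))) {S : Matrix n n ℝ}
    (hS : S = (P + _root_.weightedGram H (a t))⁻¹) (hST : Sᵀ = S) :
    HasDerivAt (fun s => -((P + _root_.weightedGram H (a s))⁻¹ * _root_.weightedGram H (c s) *
        (P + _root_.weightedGram H (a s))⁻¹).trace)
      (2 * (S * _root_.weightedGram H a' * S * _root_.weightedGram H (c t) * S).trace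
        - (S * _root_.weightedGram H c' * S).trace) t := by
  have hinv := ((ha.weightedGram H).const_add P).matrix_nonsing_inv hu
  refine (((hinv.fun_mul (hc.weightedGram H)).fun_mul hinv).matrix_trace.neg).congr_deriv ?_
  rw [← hS]
  have hcomm : (S * _root_.weightedGram H (c t) * S * _root_.weightedGram H a' * S).trace =
      (S * _root_.weightedGram H a' * S * _root_.weightedGram H (c t) * S).trace := by
    rw [← Matrix.trace_transpose]
    simp only [Matrix.transpose_mul, hST, weightedGram_transpose, Matrix.mul_assoc]
  simp only [Matrix.add_mul, Matrix.neg_mul, Matrix.mul_neg, Matrix.trace_add, Matrix.trace_neg,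
    ← Matrix.mul_assoc, hcomm]
  ring

end Calculus

section Bounds

variable {n ι : Type*} [Fintype n] [Fintype ι]

theorem Matrix.PosSemidef.dotProduct_mulVec_sq_le [DecidableEq n] {A : Matrix n n ℝ}
    (hA : A.PosSemidef)
    (x y : n → ℝ) : (x ⬝ᵥ A *ᵥ y) ^ 2 ≤ (x ⬝ᵥ A *ᵥ x) * (y ⬝ᵥ A *ᵥ y) := by
  have hpos : ∀ z, 0 ≤ Matrix.toBilin' A z z := fun z => by
    simpa [Matrix.toBilin'_apply'] using hA.dotProduct_mulVec_nonneg z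
  have hsymm : LinearMap.IsSymm (Matrix.toBilin' A) := ⟨fun u v => by
    have hT : Aᵀ = A := by simpa using hA.isHermitian.eq
    simp only [Matrix.toBilin'_apply', RingHom.id_apply]
    rw [Matrix.dotProduct_mulVec, ← Matrix.mulVec_transpose, hT, dotProduct_comm]⟩
  simpa [Matrix.toBilin'_apply'] using
    LinearMap.BilinForm.apply_sq_le_of_symm (Matrix.toBilin' A) hpos hsymm x y

theorem Matrix.PosSemidef.apply_sq_le [DecidableEq n] {A : Matrix n n ℝ} (hA : A.PosSemidef)
    (i j : n) :
    A i j ^ 2 ≤ A i i * A j j := by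
  simpa using hA.dotProduct_mulVec_sq_le (Pi.single i 1) (Pi.single j 1)

theorem dotProduct_mulVec_le_specNorm {d : ℕ} (A : Matrix (Fin d) (Fin d) ℝ) (x : Fin d → ℝ) :
    x ⬝ᵥ A *ᵥ x ≤ specNorm A * (x ⬝ᵥ x) := by
  have h1 := real_inner_le_norm (WithLp.toLp 2 x)
    (Matrix.toEuclideanCLM (𝕜 := ℝ) A (WithLp.toLp 2 x))
  have h2 := (Matrix.toEuclideanCLM (𝕜 := ℝ) A).le_opNorm (WithLp.toLp 2 x)
  have h3 : ‖WithLp.toLp 2 x‖ ^ 2 = x ⬝ᵥ x := by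
    rw [← real_inner_self_eq_norm_sq, EuclideanSpace.inner_toLp_toLp]; simp
  rw [Matrix.toEuclideanCLM_toLp, EuclideanSpace.inner_toLp_toLp, star_trivial,
    dotProduct_comm] at h1
  rw [Matrix.toEuclideanCLM_toLp] at h2
  rw [← h3, specNorm]
  nlinarith [norm_nonneg (WithLp.toLp 2 x)]

theorem posSemidef_specNorm_smul_inv_sub_one {d : ℕ} {C : Matrix (Fin d) (Fin d) ℝ}
    (hC : C.PosDef) : (specNorm C • C⁻¹ - 1).PosSemidef := by
  have hherm : (specNorm C • C⁻¹ - 1).IsHermitian := by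
    have := hC.inv.isHermitian.eq
    simp only [Matrix.IsHermitian, Matrix.conjTranspose_sub, Matrix.conjTranspose_smul, this]
    simp
  refine Matrix.PosSemidef.of_dotProduct_mulVec_nonneg hherm fun y => ?_
  set z := C⁻¹ *ᵥ y with hz
  have hy : C *ᵥ z = y := by
    rw [hz, Matrix.mulVec_mulVec, Matrix.mul_nonsing_inv _
      ((Matrix.isUnit_iff_isUnit_det _).1 hC.isUnit), Matrix.one_mulVec]
  have h1 := hC.posSemidef.dotProduct_mulVec_sq_le y z
  have h2 := dotProduct_mulVec_le_specNorm C y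
  have h3 : 0 ≤ z ⬝ᵥ C *ᵥ z := by simpa using hC.posSemidef.dotProduct_mulVec_nonneg z
  have h4 : 0 ≤ y ⬝ᵥ y := by simpa using dotProduct_star_self_nonneg y
  rw [hy] at h1 h3
  rw [star_trivial, Matrix.sub_mulVec, Matrix.smul_mulVec, ← hz, Matrix.one_mulVec,
    dotProduct_sub, dotProduct_smul, smul_eq_mul, dotProduct_comm y z]
  rcases h4.eq_or_lt with h4 | h4
  · rw [← h4]
    have : 0 ≤ specNorm C := norm_nonneg _
    have := mul_nonneg this h3
    linarith
  · have : (y ⬝ᵥ y) * (y ⬝ᵥ y) ≤ (specNorm C * (z ⬝ᵥ y)) * (y ⬝ᵥ y) := by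
      nlinarith [mul_le_mul_of_nonneg_right h2 h3]
    linarith [le_of_mul_le_mul_right this h4]

/-- The two diagonal bounds controlling the derivatives of the mean-square error. -/
theorem diag_gram_bounds [DecidableEq n] [DecidableEq ι] {P S : Matrix n n ℝ} (H : Matrix ι n ℝ)
    {ρ : ι → ℝ} {c : ℝ}
    (hρ : ∀ i, 0 ≤ ρ i) (hc : 0 ≤ c) (hP : P.PosSemidef) (hcP : (c • P - 1).PosSemidef)
    (hS : S.PosSemidef) (hSM : S * (P + Hᵀ * Matrix.diagonal ρ * H) * S = S) (i : ι) :
    ρ i * (H * S * Hᵀ) i i ≤ 1 ∧ ρ i * (H * (S * S) * Hᵀ) i i ≤ c := by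
  have hST : Sᵀ = S := by simpa using hS.isHermitian.eq
  have hconj : ∀ Q : Matrix n n ℝ, Q.PosSemidef → 0 ≤ (H * S * Q * (S * Hᵀ)) i i := fun Q hQ => by
    have h := (hQ.mul_mul_conjTranspose_same (H * S)).diag_nonneg (i := i)
    simpa [Matrix.conjTranspose_eq_transpose_of_trivial, Matrix.transpose_mul, hST] using h
  set K := H * S * Hᵀ with hK
  have hKpos : K.PosSemidef := by
    simpa [Matrix.conjTranspose_eq_transpose_of_trivial] using hS.mul_mul_conjTranspose_same H
  have hKT : Kᵀ = K := by simpa using hKpos.isHermitian.eq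
  have hKi := hKpos.diag_nonneg (i := i)
  have hP' := hconj P hP
  have hcP' := hconj _ hcP
  have hsplit : K = H * S * P * (S * Hᵀ) + K * Matrix.diagonal ρ * K := by
    calc K = H * (S * (P + Hᵀ * Matrix.diagonal ρ * H) * S) * Hᵀ := by rw [hSM]
      _ = _ := by simp only [hK, Matrix.mul_add, Matrix.add_mul, Matrix.mul_assoc]
  have hsq : ρ i * K i i ^ 2 ≤ (K * Matrix.diagonal ρ * K) i i := by
    have hexp : (K * Matrix.diagonal ρ * K) i i = ∑ j, ρ j * K i j ^ 2 := by
      rw [Matrix.mul_apply]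
      refine Finset.sum_congr rfl fun j _ => ?_
      have : K j i = K i j := congrFun (congrFun hKT i) j
      rw [Matrix.mul_diagonal, this]
      ring
    rw [hexp]
    exact Finset.single_le_sum (f := fun j => ρ j * K i j ^ 2)
      (fun j _ => mul_nonneg (hρ j) (sq_nonneg _)) (Finset.mem_univ i)
  have hKi' := congrFun (congrFun hsplit i) i
  rw [Matrix.add_apply] at hKi'
  have hone : ρ i * K i i ≤ 1 := by
    by_contra! h
    have hpos : 0 < K i i := hKi.lt_of_ne fun h0 => by rw [← h0] at h; norm_num at h
    nlinarith
  have hJ : (H * (S * S) * Hᵀ) i i ≤ c * K i i := by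
    have : H * S * (c • P - 1) * (S * Hᵀ) = c • (H * S * P * (S * Hᵀ)) - H * (S * S) * Hᵀ := by
      simp only [Matrix.mul_sub, Matrix.sub_mul, Matrix.mul_smul, Matrix.smul_mul, Matrix.mul_one,
        Matrix.mul_assoc]
    rw [this, Matrix.sub_apply, Matrix.smul_apply, smul_eq_mul] at hcP'
    have hle : (H * S * P * (S * Hᵀ)) i i ≤ K i i := by
      nlinarith [mul_nonneg (hρ i) (sq_nonneg (K i i))]
    linarith [mul_le_mul_of_nonneg_left hle hc]
  refine ⟨hone, ?_⟩
  nlinarith [mul_le_mul_of_nonneg_left hJ (hρ i), mul_le_mul_of_nonneg_left hone hc]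

theorem abs_mul_abs_gram_le [DecidableEq ι] {K J : Matrix ι ι ℝ} {ρ : ι → ℝ} {c : ℝ}
    (hρ : ∀ i, 0 ≤ ρ i)
    (hc : 0 ≤ c) (hK : K.PosSemidef) (hJ : J.PosSemidef) (hKc : ∀ i, ρ i * K i i ≤ 1)
    (hJc : ∀ i, ρ i * J i i ≤ c) (i j : ι) : |ρ i * ρ j * (K i j * J i j)| ≤ c := by
  refine abs_le_of_sq_le_sq ?_ hc
  have hKi := fun i => mul_nonneg (hρ i) (hK.diag_nonneg (i := i))
  have hJi := fun i => mul_nonneg (hρ i) (hJ.diag_nonneg (i := i))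
  have h1 : (ρ i * K i i) * (ρ j * K j j) ≤ 1 := by
    simpa using mul_le_mul (hKc i) (hKc j) (hKi j) zero_le_one
  have h2 : (ρ i * J i i) * (ρ j * J j j) ≤ c * c := mul_le_mul (hJc i) (hJc j) (hJi j) hc
  calc (ρ i * ρ j * (K i j * J i j)) ^ 2 = (ρ i * ρ j) ^ 2 * (K i j ^ 2 * J i j ^ 2) := by ring
    _ ≤ (ρ i * ρ j) ^ 2 * ((K i i * K j j) * (J i i * J j j)) := by
      gcongr
      · exact mul_nonneg hK.diag_nonneg hK.diag_nonneg
      · exact hK.apply_sq_le i j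
      · exact hJ.apply_sq_le i j
    _ = ((ρ i * K i i) * (ρ j * K j j)) * ((ρ i * J i i) * (ρ j * J j j)) := by ring
    _ ≤ 1 * (c * c) := mul_le_mul h1 h2 (mul_nonneg (hJi i) (hJi j)) zero_le_one
    _ = c ^ 2 := by ring

theorem sum_abs_mul_abs_le_norm_mul_norm (u v : EuclideanSpace ℝ ι) :
    ∑ i, |u i| * |v i| ≤ ‖u‖ * ‖v‖ := by
  simpa [EuclideanSpace.norm_eq] using
    Real.sum_mul_le_sqrt_mul_sqrt Finset.univ (fun i => |u i|) fun i => |v i|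

theorem sum_abs_mul_sum_abs_le (u v : EuclideanSpace ℝ ι) :
    (∑ i, |u i|) * ∑ i, |v i| ≤ Fintype.card ι * (‖u‖ * ‖v‖) := by
  have h : ∀ w : EuclideanSpace ℝ ι, ∑ i, |w i| ≤ √(Fintype.card ι) * ‖w‖ := fun w => by
    simpa [EuclideanSpace.norm_eq] using
      Real.sum_mul_le_sqrt_mul_sqrt Finset.univ (fun _ : ι => (1 : ℝ)) fun i => |w i|
  calc _ ≤ (√(Fintype.card ι) * ‖u‖) * (√(Fintype.card ι) * ‖v‖) := by
        gcongr
        · exact h u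
        · exact h v
    _ = (√(Fintype.card ι) * √(Fintype.card ι)) * (‖u‖ * ‖v‖) := by ring
    _ = _ := by rw [Real.mul_self_sqrt (Nat.cast_nonneg _)]

theorem trace_mul_weightedGram_mul [DecidableEq ι] (S : Matrix n n ℝ) (H : Matrix ι n ℝ)
    (e : ι → ℝ) :
    (S * weightedGram H e * S).trace = ∑ i, e i * (H * (S * S) * Hᵀ) i i := by
  calc (S * weightedGram H e * S).trace
      = ((S * Hᵀ) * (Matrix.diagonal e * (H * S))).trace := by
        simp only [weightedGram_apply, Matrix.mul_assoc]
    _ = (Matrix.diagonal e * (H * (S * S) * Hᵀ)).trace := by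
        rw [Matrix.trace_mul_comm]; simp only [Matrix.mul_assoc]
    _ = _ := by simp [Matrix.trace, Matrix.diagonal_mul]

theorem trace_mul_weightedGram_mul_weightedGram_mul [DecidableEq ι] {S : Matrix n n ℝ}
    (hST : Sᵀ = S)
    (H : Matrix ι n ℝ) (a e : ι → ℝ) :
    (S * weightedGram H a * S * weightedGram H e * S).trace =
      ∑ i, ∑ j, a i * e j * ((H * S * Hᵀ) i j * (H * (S * S) * Hᵀ) i j) := by
  have hJ : ∀ i j, (H * (S * S) * Hᵀ) j i = (H * (S * S) * Hᵀ) i j := fun i j => by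
    rw [← Matrix.transpose_apply (H * (S * S) * Hᵀ)]
    simp only [Matrix.transpose_mul, Matrix.transpose_transpose, hST, Matrix.mul_assoc]
  calc (S * weightedGram H a * S * weightedGram H e * S).trace
      = ((S * Hᵀ) * (Matrix.diagonal a * (H * S * Hᵀ) * Matrix.diagonal e * (H * S))).trace := by
        simp only [weightedGram_apply, Matrix.mul_assoc]
    _ = (Matrix.diagonal a * (H * S * Hᵀ) * Matrix.diagonal e * (H * (S * S) * Hᵀ)).trace := by
        rw [Matrix.trace_mul_comm]; simp only [Matrix.mul_assoc]
    _ = _ := by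
        simp only [Matrix.trace, Matrix.diag_apply]
        refine Finset.sum_congr rfl fun i _ => ?_
        rw [Matrix.mul_apply]
        refine Finset.sum_congr rfl fun j _ => ?_
        rw [Matrix.mul_diagonal, Matrix.diagonal_mul, hJ]
        ring

/-- Bound on the second variation of `tr (P + Hᵀ diag(ρ) H)⁻¹` under exponential reparametrization
of the weights, where `S = (P + Hᵀ diag(ρ) H)⁻¹` and `P⁻¹ ≤ c`. -/
theorem abs_second_variation_le [DecidableEq n] [DecidableEq ι] {P S : Matrix n n ℝ}
    (H : Matrix ι n ℝ) {ρ : ι → ℝ} {c : ℝ}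
    (hρ : ∀ i, 0 ≤ ρ i) (hc : 0 ≤ c) (hP : P.PosSemidef) (hcP : (c • P - 1).PosSemidef)
    (hS : S.PosSemidef) (hSM : S * (P + weightedGram H ρ) * S = S) (l : ℝ)
    (u v : EuclideanSpace ℝ ι) :
    |2 * (S * weightedGram H (fun i => l * v i * ρ i) * S *
          weightedGram H (fun i => l * u i * ρ i) * S).trace -
        (S * weightedGram H (fun i => l * u i * (l * v i * ρ i)) * S).trace| ≤
      l ^ 2 * c * (2 * Fintype.card ι + 1) * ‖v‖ * ‖u‖ := by
  have hST : Sᵀ = S := by simpa using hS.isHermitian.eq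
  have hK : (H * S * Hᵀ).PosSemidef := by
    simpa [Matrix.conjTranspose_eq_transpose_of_trivial] using hS.mul_mul_conjTranspose_same H
  have hSS : (S * S).PosSemidef := by
    simpa [Matrix.conjTranspose_eq_transpose_of_trivial, hST] using
      Matrix.posSemidef_self_mul_conjTranspose S
  have hJ : (H * (S * S) * Hᵀ).PosSemidef := by
    simpa [Matrix.conjTranspose_eq_transpose_of_trivial] using hSS.mul_mul_conjTranspose_same H
  have hdiag := diag_gram_bounds H hρ hc hP hcP hS hSM
  rw [trace_mul_weightedGram_mul, trace_mul_weightedGram_mul_weightedGram_mul hST]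
  set K := H * S * Hᵀ
  set J := H * (S * S) * Hᵀ
  have hcross : |∑ i, ∑ j, l * v i * ρ i * (l * u j * ρ j) * (K i j * J i j)| ≤
      l ^ 2 * c * (Fintype.card ι * (‖v‖ * ‖u‖)) := by
    calc _ ≤ ∑ i, ∑ j, l ^ 2 * c * (|v i| * |u j|) := by
          refine (Finset.abs_sum_le_sum_abs _ _).trans (Finset.sum_le_sum fun i _ =>
            (Finset.abs_sum_le_sum_abs _ _).trans (Finset.sum_le_sum fun j _ => ?_))
          have h := abs_mul_abs_gram_le hρ hc hK hJ (fun i => (hdiag i).1)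
            (fun i => (hdiag i).2) i j
          calc _ = |l ^ 2 * (v i * u j) * (ρ i * ρ j * (K i j * J i j))| := by congr 1; ring
            _ = l ^ 2 * (|v i| * |u j|) * |ρ i * ρ j * (K i j * J i j)| := by
              rw [abs_mul, abs_mul, abs_mul (v i), abs_of_nonneg (sq_nonneg l)]
            _ ≤ l ^ 2 * (|v i| * |u j|) * c := by gcongr
            _ = _ := by ring
      _ = l ^ 2 * c * ((∑ i, |v i|) * ∑ j, |u j|) := by
          rw [Finset.sum_mul_sum]
          simp only [Finset.mul_sum]
      _ ≤ _ := mul_le_mul_of_nonneg_left (sum_abs_mul_sum_abs_le v u) (by positivity)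
  have hself : |∑ i, l * u i * (l * v i * ρ i) * J i i| ≤ l ^ 2 * c * (‖v‖ * ‖u‖) := by
    calc _ ≤ ∑ i, l ^ 2 * c * (|v i| * |u i|) := by
          refine (Finset.abs_sum_le_sum_abs _ _).trans (Finset.sum_le_sum fun i _ => ?_)
          have h0 : 0 ≤ ρ i * J i i := mul_nonneg (hρ i) hJ.diag_nonneg
          calc _ = |l ^ 2 * (v i * u i) * (ρ i * J i i)| := by congr 1; ring
            _ = l ^ 2 * (|v i| * |u i|) * (ρ i * J i i) := by
              rw [abs_mul, abs_mul, abs_mul (v i), abs_of_nonneg (sq_nonneg l), abs_of_nonneg h0]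
            _ ≤ l ^ 2 * (|v i| * |u i|) * c := by gcongr; exact (hdiag i).2
            _ = _ := by ring
      _ = l ^ 2 * c * ∑ i, |v i| * |u i| := by rw [Finset.mul_sum]
      _ ≤ _ :=
          mul_le_mul_of_nonneg_left (sum_abs_mul_abs_le_norm_mul_norm v u) (by positivity)
  refine (abs_sub _ _).trans ?_
  rw [abs_mul, abs_two]
  linarith

end Bounds

/-- Lipschitz gradient bound: `F(b) = f(ρ(b))` with
`ρ_i(b) = κ_i 4^{b_i}` is `C^∞` on `ℝ^m`, its Hessian satisfies
`‖∇²F(b)‖ ≤ (ln 4)² ‖C_x‖₂ (2m+1)` for all `b`, and hence `∇F` is Lipschitz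
with constant `L = (ln 4)² ‖C_x‖₂ (2m+1)`. -/
theorem stmt10 {m d : ℕ} (H : Matrix (Fin m) (Fin d) ℝ)
    (Cx : Matrix (Fin d) (Fin d) ℝ) (hCx : Cx.PosDef)
    (κ : Fin m → ℝ) (hκ : ∀ i, 0 < κ i)
    (F : EuclideanSpace ℝ (Fin m) → ℝ)
    (hF : F = fun b => (Cx⁻¹ + Hᵀ * Matrix.diagonal
        (fun j => κ j * (4 : ℝ) ^ (b j)) * H)⁻¹.trace)
    (L : ℝ) (hL : L = (Real.log 4) ^ 2 * specNorm Cx * (2 * m + 1)) :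
    ContDiff ℝ (⊤ : ℕ∞) F ∧
    (∀ b : EuclideanSpace ℝ (Fin m), ‖fderiv ℝ (fderiv ℝ F) b‖ ≤ L) ∧
    (∀ b b' : EuclideanSpace ℝ (Fin m),
      ‖fderiv ℝ F b - fderiv ℝ F b'‖ ≤ L * ‖b - b'‖) := by
  have hκ' : ∀ (b : EuclideanSpace ℝ (Fin m)) j, 0 ≤ κ j * (4 : ℝ) ^ b j := fun b j =>
    mul_nonneg (hκ j).le (by positivity)
  set ρ : EuclideanSpace ℝ (Fin m) → Fin m → ℝ := fun b j => κ j * (4 : ℝ) ^ b j with hρ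
  have hF' : F = fun b => (Cx⁻¹ + weightedGram H (ρ b))⁻¹.trace := hF
  have hM : ∀ b, (Cx⁻¹ + weightedGram H (ρ b)).PosDef := fun b => by
    refine hCx.inv.add_posSemidef ?_
    simpa [weightedGram_apply, Matrix.conjTranspose_eq_transpose_of_trivial] using
      (Matrix.posSemidef_diagonal_iff.2 (hκ' b)).conjTranspose_mul_mul_same H
  have hsmooth : ContDiff ℝ (⊤ : ℕ∞) F := by
    rw [hF']
    refine contDiff_trace_inv_add_weightedGram _ _ ?_ fun b => (hM b).isUnit
    refine contDiff_pi.2 fun j => contDiff_const.mul ?_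
    exact contDiff_const.rpow (by fun_prop) fun _ => by norm_num
  have hline : ∀ (b v : EuclideanSpace ℝ (Fin m)) (t : ℝ),
      HasDerivAt (fun s : ℝ => ρ (b + s • v))
        (fun j => Real.log 4 * v j * ρ (b + t • v) j) t := fun b v t => by
    refine hasDerivAt_pi.2 fun j => ?_
    have h : HasDerivAt (fun s : ℝ => (b + s • v) j) (v j) t := by
      simpa using ((hasDerivAt_id t).mul_const (v j)).const_add (b j)
    refine ((h.const_rpow (by norm_num : (0 : ℝ) < 4)).const_mul (κ j)).congr_deriv ?_
    simp only [hρ]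
    ring
  have hfderiv : ∀ b v : EuclideanSpace ℝ (Fin m), fderiv ℝ F b v =
      -((Cx⁻¹ + weightedGram H (ρ b))⁻¹ * weightedGram H (fun j => Real.log 4 * v j * ρ b j) *
        (Cx⁻¹ + weightedGram H (ρ b))⁻¹).trace := fun b v => by
    have h1 : HasDerivAt (fun s : ℝ => F (b + s • v)) (fderiv ℝ F b v) 0 :=
      ((hsmooth.differentiable (by simp)) b).hasFDerivAt.hasLineDerivAt v
    have h2 := (hline b v 0).trace_inv_add_weightedGram Cx⁻¹ H (hM _).isUnit
    rw [hF'] at h1 ⊢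
    simpa using h1.unique h2
  have hdiff : Differentiable ℝ (fderiv ℝ F) :=
    (hsmooth.fderiv_right (m := 1) (by norm_cast)).differentiable (by simp)
  have hbound : ∀ b : EuclideanSpace ℝ (Fin m), ‖fderiv ℝ (fderiv ℝ F) b‖ ≤ L := fun b => by
    have hc : 0 ≤ specNorm Cx := norm_nonneg _
    have hL0 : 0 ≤ L := by rw [hL]; positivity
    refine ContinuousLinearMap.opNorm_le_bound₂ _ hL0 fun v u => ?_
    have hdiffu : HasFDerivAt (fun x => fderiv ℝ F x u)
        ((fderiv ℝ (fderiv ℝ F) b).flip u) b := by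
      simpa using (hdiff b).hasFDerivAt.clm_apply (hasFDerivAt_const u b)
    have h1 := hdiffu.hasLineDerivAt v
    simp only [HasLineDerivAt, hfderiv] at h1
    have hunit := (hM b).isUnit
    have hvar : HasDerivAt (fun s : ℝ => fun j => Real.log 4 * u j * ρ (b + s • v) j)
        (fun j => Real.log 4 * u j * (Real.log 4 * v j * ρ b j)) 0 := by
      refine hasDerivAt_pi.2 fun j => ?_
      simpa using (hasDerivAt_pi.1 (hline b v 0) j).const_mul (Real.log 4 * u j)
    have hS := (hM b).inv.posSemidef
    have h2 := (hline b v 0).trace_inv_mul_weightedGram_mul_inv Cx⁻¹ H hvar (hM _).isUnit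
      (S := (Cx⁻¹ + weightedGram H (ρ b))⁻¹) (by simp) (by simpa using hS.isHermitian.eq)
    have h3 := h1.unique h2
    simp only [zero_smul, add_zero, ContinuousLinearMap.flip_apply] at h3
    have hSM : (Cx⁻¹ + weightedGram H (ρ b))⁻¹ * (Cx⁻¹ + weightedGram H (ρ b)) *
        (Cx⁻¹ + weightedGram H (ρ b))⁻¹ = (Cx⁻¹ + weightedGram H (ρ b))⁻¹ := by
      rw [Matrix.nonsing_inv_mul _ ((Matrix.isUnit_iff_isUnit_det _).1 hunit), Matrix.one_mul]
    rw [h3, Real.norm_eq_abs, hL]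
    simpa using abs_second_variation_le H (hκ' b) hc hCx.inv.posSemidef
      (posSemidef_specNorm_smul_inv_sub_one hCx) hS hSM (Real.log 4) u v
  exact ⟨hsmooth, hbound, fun b b' => convex_univ.norm_image_sub_le_of_norm_fderiv_le
    (fun x _ => hdiff x) (fun x _ => hbound x) (Set.mem_univ b') (Set.mem_univ b)⟩
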